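/- For every robot grid search problem (X, U, f) there exists a single finite action sequence ũ = (u_1, …, u_K) such that for every initial state x_I ∈ X, the trajectory x_1 = x_I, x_{k+1} = f(x_k, u_k) visits every state of X, i.e., {x_1, …, x_{K+1}} = X. -/

import Mathlib

/-- The four unit-length grid actions `left, right, up, down`. -/
def Ugrid : Set (ℤ × ℤ) := {(-1, 0), (1, 0), (0, 1), (0, -1)}

/-- A subset `Z ⊆ ℤ×ℤ` is a connected grid if any two of its points are joined by
a finite chain of points of `Z` in which consecutive points are at (Euclidean)
distance `1`, i.e. the coordinate differences have absolute values summing to `1`. -/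
def ConnectedGrid (Z : Set (ℤ × ℤ)) : Prop :=
  ∀ z1 ∈ Z, ∀ z2 ∈ Z, ∃ n : ℕ, ∃ x : Fin (n + 1) → ℤ × ℤ,
    (∀ k, x k ∈ Z) ∧ x 0 = z1 ∧ x (Fin.last n) = z2 ∧
    ∀ k : Fin n, ((x k.succ).1 - (x k.castSucc).1).natAbs
      + ((x k.succ).2 - (x k.castSucc).2).natAbs = 1

/-- The stay-put transition function: `f(x,u) = x + u` if `x + u ∈ X`, else `x`. -/
noncomputable def fstep (X : Set (ℤ × ℤ)) (x u : ℤ × ℤ) : ℤ × ℤ :=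
  @ite _ (x + u ∈ X) (Classical.propDecidable _) (x + u) x

theorem fstep_mem {X : Set (ℤ × ℤ)} {x : ℤ × ℤ} (hx : x ∈ X) (u : ℤ × ℤ) :
    fstep X x u ∈ X := by
  unfold fstep
  split_ifs with h
  exacts [h, hx]

theorem foldl_fstep_mem {X : Set (ℤ × ℤ)} (us : List (ℤ × ℤ)) {x : ℤ × ℤ} (hx : x ∈ X) :
    us.foldl (fstep X) x ∈ X := by
  induction us generalizing x with
  | nil => exact hx
  | cons u us ih => exact ih (fstep_mem hx u)

theorem sub_mem_Ugrid {x y : ℤ × ℤ}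
    (h : (y.1 - x.1).natAbs + (y.2 - x.2).natAbs = 1) : y - x ∈ Ugrid := by
  simp only [Ugrid, Set.mem_insert_iff, Set.mem_singleton_iff, Prod.ext_iff, Prod.fst_sub,
    Prod.snd_sub]
  omega

/-- In a connected grid, every state can be steered to every other state. -/
theorem ConnectedGrid.exists_foldl_fstep_eq {X : Set (ℤ × ℤ)} (hX : ConnectedGrid X)
    {a b : ℤ × ℤ} (ha : a ∈ X) (hb : b ∈ X) :
    ∃ us : List (ℤ × ℤ), (∀ u ∈ us, u ∈ Ugrid) ∧ us.foldl (fstep X) a = b := by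
  obtain ⟨n, x, hmem, rfl, rfl, hstep⟩ := hX a ha b hb
  suffices ∀ k : Fin (n + 1), ∃ us : List (ℤ × ℤ), (∀ u ∈ us, u ∈ Ugrid) ∧
      us.foldl (fstep X) (x 0) = x k from this _
  intro k
  induction k using Fin.induction with
  | zero => exact ⟨[], by simp, rfl⟩
  | succ k ih =>
    obtain ⟨us, hus, hend⟩ := ih
    refine ⟨us ++ [x k.succ - x k.castSucc], ?_, ?_⟩
    · intro u hu
      rcases List.mem_append.1 hu with hu | hu
      · exact hus u hu
      · rw [List.mem_singleton.1 hu]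
        exact sub_mem_Ugrid (hstep k)
    · simp [List.foldl_append, hend, fstep, hmem]

/-- Any finite set of requests to visit `p.2` when started at `p.1` is met by one action sequence. -/
theorem ConnectedGrid.exists_forall_visits {X : Set (ℤ × ℤ)} (hX : ConnectedGrid X)
    {S : Set ((ℤ × ℤ) × (ℤ × ℤ))} (hS : S.Finite) (hSX : S ⊆ X ×ˢ X) :
    ∃ us : List (ℤ × ℤ), (∀ u ∈ us, u ∈ Ugrid) ∧
      ∀ p ∈ S, ∃ vs, vs <+: us ∧ vs.foldl (fstep X) p.1 = p.2 := by
  induction S, hS using Set.Finite.induction_on with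
  | empty => exact ⟨[], by simp, by simp⟩
  | @insert p S _ _ ih =>
    obtain ⟨hp, hS⟩ := Set.insert_subset_iff.1 hSX
    obtain ⟨us, hus, hvisit⟩ := ih hS
    obtain ⟨ws, hws, hend⟩ := hX.exists_foldl_fstep_eq (foldl_fstep_mem us hp.1) hp.2
    refine ⟨us ++ ws, fun u hu => (List.mem_append.1 hu).elim (hus u) (hws u), ?_⟩
    rintro q (rfl | hq)
    · exact ⟨us ++ ws, List.prefix_rfl, by rw [List.foldl_append, hend]⟩
    · obtain ⟨vs, hvs, h⟩ := hvisit q hq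
      exact ⟨vs, hvs.trans (List.prefix_append us ws), h⟩


/-- **A single finite action sequence visiting all states from every start.**
For every robot grid search problem there is one finite action sequence such that,
from any initial state, the induced trajectory (the successive states reached by the
prefixes of the sequence) visits exactly the whole state space `X`. -/
theorem stmt3 (X : Set (ℤ × ℤ)) (hfin : X.Finite) (hne : X.Nonempty)
    (hconn : ConnectedGrid X) :
    ∃ us : List (ℤ × ℤ), (∀ u ∈ us, u ∈ Ugrid) ∧
      ∀ xI ∈ X, {y : ℤ × ℤ | ∃ k ≤ us.length, (us.take k).foldl (fstep X) xI = y} = X := by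
  obtain ⟨us, hus, hvisit⟩ := hconn.exists_forall_visits (hfin.prod hfin) subset_rfl
  refine ⟨us, hus, fun xI hxI => Set.Subset.antisymm ?_ fun y hy => ?_⟩
  · rintro y ⟨k, -, rfl⟩
    exact foldl_fstep_mem _ hxI
  · obtain ⟨vs, hvs, h⟩ := hvisit (xI, y) ⟨hxI, hy⟩
    exact ⟨vs.length, hvs.length_le, by rw [← List.prefix_iff_eq_take.1 hvs, h]⟩
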